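/- arXiv:2111.08328 — 2 statements merged into one kernel-verified Lean document; each statement's English description precedes it below -/
import Mathlib

section
/- For every integer r>3, there exists a strongly temporalisable trip network (D_r,𝕋_r) with exactly n=r²+2r nodes such that, for every temporalisation τ of (D_r,𝕋_r), the τ-reachability of (D_r,𝕋_r) is at most 15·n·√n. -/
/-- A weighted directed edge of a weighted directed multigraph. -/
structure DEdge (V : Type) where
  tail : V
  head : V
  weight : ℝ

/-- A temporal edge: tail, head, starting time and (positive) travel time. -/
structure TEdge (V : Type) where
  tail : V
  head : V
  time : ℝ
  travel : ℝ

/-- A trip: a nonempty walk, i.e. consecutive edges match head-to-tail. -/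
def IsWalk {V : Type} (T : List (DEdge V)) : Prop :=
  T ≠ [] ∧ T.Chain' fun e f => e.head = f.tail

/-- A trip network: every trip is a walk with positive weights, and every node
appears in some trip (the edges of `D` are exactly the edges of the trips). -/
def IsTripNetwork {V : Type} (trips : List (List (DEdge V))) : Prop :=
  (∀ T ∈ trips, IsWalk T ∧ ∀ e ∈ T, 0 < e.weight) ∧
  ∀ v : V, ∃ T ∈ trips, ∃ e ∈ T, e.tail = v ∨ e.head = v

/-- A temporal path from `u` to `v` in the temporal graph `G`. -/
def IsTemporalPath {V : Type} (G : Set (TEdge V)) (p : List (TEdge V)) (u v : V) : Prop :=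
  p ≠ [] ∧ (∀ f ∈ p, f ∈ G) ∧
  (p.Chain' fun e f => e.head = f.tail ∧ e.time + e.travel ≤ f.time) ∧
  p.head?.map TEdge.tail = some u ∧ p.getLast?.map TEdge.head = some v

/-- Temporal reachability (every node temporally reaches itself). -/
def TReachable {V : Type} (G : Set (TEdge V)) (u v : V) : Prop :=
  u = v ∨ ∃ p, IsTemporalPath G p u v

/-- The temporal edges induced by a trip with starting time `t`. -/
def tripTEdges {V : Type} : List (DEdge V) → ℝ → List (TEdge V)
  | [], _ => []
  | e :: es, t => ⟨e.tail, e.head, t, e.weight⟩ :: tripTEdges es (t + e.weight)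

/-- The temporal graph induced by a temporalisation `τ` assigning a starting
time to each trip (index) of the collection. -/
def inducedTG {V : Type} (trips : List (List (DEdge V))) (τ : ℕ → ℝ) : Set (TEdge V) :=
  { f | ∃ i : Fin trips.length, f ∈ tripTEdges (trips.get i) (τ i.1) }

/-- The duration of a trip: the sum of the weights of its edges. -/
def tripDuration {V : Type} (T : List (DEdge V)) : ℝ :=
  (T.map DEdge.weight).sum

/-- Starting time of the `i`-th trip of a schedule: the sum of the durations of
the previous trips. -/
def scheduleTimes {V : Type} (S : List (List (DEdge V))) (i : ℕ) : ℝ :=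
  ((S.take i).map tripDuration).sum

/-- The temporal graph induced by a schedule (an ordering of the trips). -/
def scheduleTG {V : Type} (S : List (List (DEdge V))) : Set (TEdge V) :=
  inducedTG S (scheduleTimes S)

/-- The number of ordered pairs `(u, v)` of nodes such that `v` is temporally
reachable from `u` in `G`. -/
noncomputable def reachCount {V : Type} [Fintype V] (G : Set (TEdge V)) : ℕ :=
  Nat.card {p : V × V // TReachable G p.1 p.2}

/-- `(s,t)`-temporalisability. -/
def Temporalisable {V : Type} (trips : List (List (DEdge V))) (s t : V) : Prop :=
  ∃ τ : ℕ → ℝ, TReachable (inducedTG trips τ) s t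

/-- Strong temporalisability. -/
def StronglyTemporalisable {V : Type} (trips : List (List (DEdge V))) : Prop :=
  ∀ s t : V, Temporalisable trips s t

/-- The sequence of nodes visited by a trip. -/
def tripNodes {V : Type} (T : List (DEdge V)) : List V :=
  T.map DEdge.tail ++ (T.getLast?.map DEdge.head).toList

/-- A symmetric trip collection: the trips can be grouped into disjoint pairs
`(T, T̄)` where `T̄` visits the same nodes as `T` in reverse order. -/
def IsSymmetricTrips {V : Type} (trips : List (List (DEdge V))) : Prop :=
  ∃ ps : List (List (DEdge V) × List (DEdge V)),
    trips.Perm (ps.flatMap fun p => [p.1, p.2]) ∧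
    ∀ p ∈ ps, tripNodes p.2 = (tripNodes p.1).reverse

/-- Reachability by a walk in the underlying multidigraph. -/
def DReachable {V : Type} (trips : List (List (DEdge V))) (u v : V) : Prop :=
  Relation.ReflTransGen (fun a b => ∃ T ∈ trips, ∃ e ∈ T, e.tail = a ∧ e.head = b) u v

/-- Arrival at a node at a given time along a temporal path leaving `s`. -/
inductive ArrivesAt {V : Type} (G : Set (TEdge V)) (s : V) : V → ℝ → Prop
  | start (f : TEdge V) (hf : f ∈ G) (hs : f.tail = s) :
      ArrivesAt G s f.head (f.time + f.travel)
  | step {v : V} {t : ℝ} (h : ArrivesAt G s v t) (f : TEdge V) (hf : f ∈ G)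
      (hv : f.tail = v) (ht : t ≤ f.time) : ArrivesAt G s f.head (f.time + f.travel)

theorem ArrivesAt.tReachable {V : Type} {G : Set (TEdge V)} {s v : V} {t : ℝ}
    (h : ArrivesAt G s v t) : TReachable G s v := by
  suffices H : ∃ p l, IsTemporalPath G p s v ∧ p.getLast? = some l ∧ l.time + l.travel = t by
    obtain ⟨p, l, hp, -⟩ := H
    exact Or.inr ⟨p, hp⟩
  induction h with
  | start f hf hs =>
    refine ⟨[f], f, ⟨by simp, by simpa using hf, ?_, by simp [hs], by simp⟩, by simp, rfl⟩
    exact List.isChain_singleton f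
  | @step v t _ f hf hv ht ih =>
    obtain ⟨p, l, ⟨hne, hG, hc, hh, hl⟩, hlast, htime⟩ := ih
    refine ⟨p ++ [f], f, ⟨by simp, ?_, ?_, ?_, by simp⟩, by simp, rfl⟩
    · intro g hg
      rcases List.mem_append.1 hg with hg | hg
      · exact hG g hg
      · rw [List.mem_singleton.1 hg]
        exact hf
    · refine List.isChain_append.2 ⟨hc, List.isChain_singleton f, ?_⟩
      intro x hx y hy
      have hxl : l = x := by simpa [hlast] using hx
      have hyf : f = y := by simpa using hy
      subst hxl hyf
      have : l.head = v := by simpa [hlast] using hl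
      exact ⟨this.trans hv.symm, htime ▸ ht⟩
    · rw [List.head?_append_of_ne_nil _ hne]
      exact hh

theorem ArrivesAt.trans_path {V : Type} {G : Set (TEdge V)} {s v : V} (p : List (TEdge V)) :
    ∀ {u : V} {t : ℝ}, ArrivesAt G s u t → IsTemporalPath G p u v →
      (∀ f ∈ p.head?, t ≤ f.time) → ∃ t', ArrivesAt G s v t' := by
  induction p with
  | nil => exact fun _ h => absurd rfl h.1
  | cons f p ih =>
    rintro u t hu ⟨-, hG, hc, hh, hl⟩ ht
    have hft : f.tail = u := by simpa using hh
    have harr := hu.step f (hG f (by simp)) hft (ht f (by simp))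
    cases p with
    | nil =>
      have : f.head = v := by simpa using hl
      exact ⟨_, this ▸ harr⟩
    | cons g p =>
      have hc' := List.isChain_cons_cons.1 hc
      refine ih harr ⟨by simp, fun x hx => hG x (List.mem_cons_of_mem _ hx), hc'.2, ?_, ?_⟩ ?_
      · simp [hc'.1.1]
      · simpa using hl
      · simpa using hc'.1.2

theorem TReachable.exists_arrivesAt {V : Type} {G : Set (TEdge V)} {s v : V}
    (h : TReachable G s v) (hne : s ≠ v) : ∃ t, ArrivesAt G s v t := by
  obtain ⟨p, hne, hG, hc, hh, hl⟩ := h.resolve_left hne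
  cases p with
  | nil => exact absurd rfl hne
  | cons f p =>
    have harr := ArrivesAt.start (s := s) f (hG f (by simp)) (by simpa using hh)
    cases p with
    | nil =>
      have : f.head = v := by simpa using hl
      exact ⟨_, this ▸ harr⟩
    | cons g p =>
      have hc' := List.isChain_cons_cons.1 hc
      refine harr.trans_path (g :: p)
        ⟨by simp, fun x hx => hG x (List.mem_cons_of_mem _ hx), hc'.2, ?_, ?_⟩ ?_
      · simp [hc'.1.1]
      · simpa using hl
      · simpa using hc'.1.2

/-- The zigzag trip `k, k+1, k-1, k, …, 0, 1, r+i, 0` with unit weights: riding it once, one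
climbs by at most one among the nodes `0, …, k+1`. -/
def zigzag {V : Type} (N : ℕ → V) (r i : ℕ) : ℕ → List (DEdge V)
  | 0 => [⟨N 0, N 1, 1⟩, ⟨N 1, N (r + i), 1⟩, ⟨N (r + i), N 0, 1⟩]
  | k + 1 => ⟨N (k + 1), N (k + 2), 1⟩ :: ⟨N (k + 2), N k, 1⟩ :: zigzag N r i k

/-- The trips: from the hub `r-1` to every node, from every node to the node `r + i` of its
class `i` modulo `r`, and one zigzag per class. -/
def hubTrip {V : Type} (N : ℕ → V) (r n m : ℕ) : List (DEdge V) :=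
  if m < n then [⟨N (r - 1), N m, 1⟩]
  else if m < 2 * n then [⟨N (m - n), N (r + (m - n) % r), 1⟩]
  else zigzag N r (m - 2 * n) (r - 2)

/-- The full collection of `2n + r` trips. -/
def hubTrips {V : Type} (N : ℕ → V) (r n : ℕ) : List (List (DEdge V)) :=
  (List.range (2 * n + r)).map (hubTrip N r n)

theorem mem_inducedTG_hubTrips {V : Type} {N : ℕ → V} {r n : ℕ} {τ : ℕ → ℝ} {f : TEdge V} :
    f ∈ inducedTG (hubTrips N r n) τ ↔
      ∃ m < 2 * n + r, f ∈ tripTEdges (hubTrip N r n m) (τ m) := by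
  constructor
  · rintro ⟨⟨m, hm⟩, hf⟩
    refine ⟨m, by simpa [hubTrips] using hm, by simpa [hubTrips] using hf⟩
  · rintro ⟨m, hm, hf⟩
    exact ⟨⟨m, by simpa [hubTrips] using hm⟩, by simpa [hubTrips] using hf⟩

/-- The temporal edges are those leaving the hub, those leading to a class node, and those
of the zigzags. -/
theorem inducedTG_hubTrips_cases {V : Type} {N : ℕ → V} {r n : ℕ} {τ : ℕ → ℝ} {f : TEdge V}
    (hf : f ∈ inducedTG (hubTrips N r n) τ) :
    (f.tail = N (r - 1)) ∨
    (∃ v < n, f.tail = N v ∧ f.head = N (r + v % r) ∧ f.travel = 1) ∨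
    ∃ j < r, f ∈ tripTEdges (zigzag N r j (r - 2)) (τ (2 * n + j)) := by
  obtain ⟨m, hm, hf⟩ := mem_inducedTG_hubTrips.1 hf
  unfold hubTrip at hf
  split_ifs at hf with h1 h2
  · left
    simp only [tripTEdges, List.mem_singleton] at hf
    rw [hf]
  · right; left
    simp only [tripTEdges, List.mem_singleton] at hf
    exact ⟨m - n, by omega, by rw [hf], by rw [hf], by rw [hf]⟩
  · right; right
    exact ⟨m - 2 * n, by omega, by rwa [Nat.add_sub_cancel' (by omega)]⟩

theorem isChain_zigzag {V : Type} (N : ℕ → V) (r i k : ℕ) :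
    (zigzag N r i k).IsChain (fun e f => e.head = f.tail) ∧
      (zigzag N r i k).head?.map DEdge.tail = some (N k) := by
  induction k with
  | zero => simp [zigzag]
  | succ k ih =>
    refine ⟨?_, by simp [zigzag]⟩
    rw [zigzag]
    refine List.isChain_cons_cons.2 ⟨rfl, ?_⟩
    refine List.isChain_cons.2 ⟨?_, ih.1⟩
    intro y hy
    have h := ih.2
    rw [Option.mem_def.1 hy] at h
    exact (Option.some.inj h).symm

theorem weight_of_mem_zigzag {V : Type} (N : ℕ → V) (r i k : ℕ) :
    ∀ e ∈ zigzag N r i k, e.weight = 1 := by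
  induction k with
  | zero => simp [zigzag]
  | succ k ih => simpa [zigzag] using ih

theorem zigzag_ne_nil {V : Type} (N : ℕ → V) (r i k : ℕ) : zigzag N r i k ≠ [] := by
  cases k <;> simp [zigzag]

theorem zigzag_time {V : Type} (N : ℕ → V) (r i k : ℕ) :
    ∀ (t : ℝ), ∀ f ∈ tripTEdges (zigzag N r i k) t,
      t ≤ f.time ∧ f.travel = 1 ∧ f.time + f.travel ≤ t + (2 * k + 3) := by
  induction k with
  | zero =>
    intro t f hf
    simp only [zigzag, tripTEdges, List.mem_cons, List.not_mem_nil, or_false] at hf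
    rcases hf with rfl | rfl | rfl <;> refine ⟨?_, rfl, ?_⟩ <;> norm_num <;> linarith
  | succ k ih =>
    intro t f hf
    simp only [zigzag, tripTEdges, List.mem_cons] at hf
    push_cast
    have hk : (0 : ℝ) ≤ k := k.cast_nonneg
    rcases hf with rfl | rfl | hf
    · refine ⟨le_rfl, rfl, ?_⟩
      simp only
      linarith
    · refine ⟨?_, rfl, ?_⟩ <;> simp only <;> linarith
    · obtain ⟨h1, h2, h3⟩ := ih _ f hf
      exact ⟨by linarith, h2, by linarith⟩

/-- Every step `k → k+1` of the staircase is available on the zigzag. -/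
theorem exists_climb_mem_zigzag {V : Type} (N : ℕ → V) (r i : ℕ) {k K : ℕ} (hk : k ≤ K) :
    ∀ t : ℝ, ∃ f ∈ tripTEdges (zigzag N r i K) t, f.tail = N k ∧ f.head = N (k + 1) := by
  induction K with
  | zero =>
    intro t
    obtain rfl : k = 0 := by omega
    exact ⟨_, List.mem_cons_self, rfl, rfl⟩
  | succ K ih =>
    intro t
    rcases hk.eq_or_lt with rfl | hk
    · exact ⟨_, List.mem_cons_self, rfl, rfl⟩
    · obtain ⟨f, hf, h⟩ := ih (by omega) (t + 1 + 1)
      exact ⟨f, List.mem_cons_of_mem _ (List.mem_cons_of_mem _ hf), h⟩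

theorem exists_entry_mem_zigzag {V : Type} (N : ℕ → V) (r i K : ℕ) :
    ∀ t : ℝ, ∃ f ∈ tripTEdges (zigzag N r i K) t, f.tail = N (r + i) ∧ f.head = N 0 := by
  induction K with
  | zero =>
    intro t
    exact ⟨_, List.mem_cons_of_mem _ (List.mem_cons_of_mem _ List.mem_cons_self), rfl, rfl⟩
  | succ K ih =>
    intro t
    obtain ⟨f, hf, h⟩ := ih (t + 1 + 1)
    exact ⟨f, List.mem_cons_of_mem _ (List.mem_cons_of_mem _ hf), h⟩

/-- The height of a node: its index on the staircase `0, …, r-1`, and zero elsewhere. -/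
def height (r v : ℕ) : ℕ := if v < r then v else 0

theorem zigzag_head_height {n r : ℕ} {N : ℕ → Fin n} (hN : ∀ k < n, (N k : ℕ) = k)
    (hn : 2 * r ≤ n) {i : ℕ} (hi : i < r) {k : ℕ} (hk : k + 1 < r) :
    ∀ t : ℝ, ∀ f ∈ tripTEdges (zigzag N r i k) t, height r f.head ≤ k + 1 := by
  induction k with
  | zero =>
    intro t f hf
    simp only [zigzag, tripTEdges, List.mem_cons, List.not_mem_nil, or_false] at hf
    rcases hf with rfl | rfl | rfl <;> simp only <;> rw [hN _ (by omega)] <;>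
      unfold height <;> split_ifs <;> omega
  | succ k ih =>
    intro t f hf
    simp only [zigzag, tripTEdges, List.mem_cons] at hf
    rcases hf with rfl | rfl | hf
    · simp only
      rw [hN _ (by omega)]
      unfold height
      split_ifs <;> omega
    · simp only
      rw [hN _ (by omega)]
      unfold height
      split_ifs <;> omega
    · exact (ih (by omega) _ f hf).trans (by omega)

theorem zigzag_height_le {n r : ℕ} {N : ℕ → Fin n} (hN : ∀ k < n, (N k : ℕ) = k)
    (hn : 2 * r ≤ n) {i : ℕ} (hi : i < r) {k : ℕ} (hk : k + 1 < r) :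
    ∀ t : ℝ, ∀ f ∈ tripTEdges (zigzag N r i k) t, ∀ g ∈ tripTEdges (zigzag N r i k) t,
      f.time ≤ g.time → height r g.head ≤ height r f.tail + 1 := by
  induction k with
  | zero =>
    intro t f _ g hg _
    have := zigzag_head_height hN hn hi hk t g hg
    omega
  | succ k ih =>
    intro t f hf g hg hfg
    have hgk := zigzag_head_height hN hn hi hk t g hg
    simp only [zigzag, tripTEdges, List.mem_cons] at hf
    have hN1 : (N (k + 1) : ℕ) = k + 1 := hN _ (by omega)
    have hN2 : (N (k + 2) : ℕ) = k + 2 := hN _ (by omega)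
    rcases hf with rfl | rfl | hf
    · simp only [hN1, height, if_pos (show k + 1 < r by omega)] at hgk ⊢
      exact hgk
    · simp only [hN2, height, if_pos (show k + 2 < r by omega)] at hgk ⊢
      omega
    · have hft := (zigzag_time N r i k _ f hf).1
      simp only [zigzag, tripTEdges, List.mem_cons] at hg
      rcases hg with rfl | rfl | hg
      · simp only at hfg
        linarith
      · simp only at hfg
        linarith
      · exact ih (by omega) _ f hf g hg hfg

theorem zigzag_lt {n r : ℕ} {N : ℕ → Fin n} (hN : ∀ k < n, (N k : ℕ) = k)
    (hn : 2 * r ≤ n) {i : ℕ} (hi : i < r) {k : ℕ} (hk : k + 1 < r) :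
    ∀ t : ℝ, ∀ f ∈ tripTEdges (zigzag N r i k) t,
      (f.tail : ℕ) < 2 * r ∧ (f.head : ℕ) < 2 * r ∧
      (r ≤ (f.tail : ℕ) → (f.tail : ℕ) = r + i ∧ f.head = N 0 ∧
        f.time + f.travel = t + (2 * k + 3)) := by
  induction k with
  | zero =>
    intro t f hf
    simp only [zigzag, tripTEdges, List.mem_cons, List.not_mem_nil, or_false] at hf
    have h0 : (N 0 : ℕ) = 0 := hN _ (by omega)
    have h1 : (N 1 : ℕ) = 1 := hN _ (by omega)
    have h2 : (N (r + i) : ℕ) = r + i := hN _ (by omega)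
    rcases hf with rfl | rfl | rfl
    · simp only [h0, h1]
      exact ⟨by omega, by omega, fun h => by omega⟩
    · simp only [h2, h1]
      exact ⟨by omega, by omega, fun h => by omega⟩
    · simp only [h2, h0]
      refine ⟨by omega, by omega, fun _ => ⟨trivial, trivial, ?_⟩⟩
      push_cast
      ring
  | succ k ih =>
    intro t f hf
    simp only [zigzag, tripTEdges, List.mem_cons] at hf
    have h0 : (N k : ℕ) = k := hN _ (by omega)
    have h1 : (N (k + 1) : ℕ) = k + 1 := hN _ (by omega)
    have h2 : (N (k + 2) : ℕ) = k + 2 := hN _ (by omega)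
    rcases hf with rfl | rfl | hf
    · simp only [h1, h2]
      exact ⟨by omega, by omega, fun h => by omega⟩
    · simp only [h0, h2]
      exact ⟨by omega, by omega, fun h => by omega⟩
    · obtain ⟨ha, hb, hc⟩ := ih (by omega) _ f hf
      refine ⟨ha, hb, fun h => ?_⟩
      obtain ⟨h1, h2, h3⟩ := hc h
      exact ⟨h1, h2, by rw [h3]; push_cast; ring⟩

/-- A traveller of class `i` that gets anywhere beyond the staircase needs the zigzag of its
class to run strictly before all the others. -/
theorem zigzag_first_of_arrivesAt {n r : ℕ} {N : ℕ → Fin n} (hN : ∀ k < n, (N k : ℕ) = k)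
    (hr : 2 ≤ r) (hn : 2 * r ≤ n) {τ : ℕ → ℝ} {s v : Fin n} {t : ℝ}
    (hs : 2 * r ≤ (s : ℕ)) (hv : 2 * r ≤ (v : ℕ))
    (h : ArrivesAt (inducedTG (hubTrips N r n) τ) s v t) :
    ∀ j < r, j ≠ s % r → τ (2 * n + s % r) < τ (2 * n + j) := by
  have hi : (s : ℕ) % r < r := Nat.mod_lt _ (by omega)
  set i := (s : ℕ) % r with hidef
  have hNi : (N (r + i) : ℕ) = r + i := hN _ (by omega)
  have hhub : (N (r - 1) : ℕ) = r - 1 := hN _ (by omega)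
  set D : ℝ := 2 * ((r - 2 : ℕ) : ℝ) + 3 with hD
  have hk : r - 2 + 1 < r := by omega
  suffices H : (∀ j < r, j ≠ i → τ (2 * n + i) < τ (2 * n + j)) ∨ v = N (r + i) ∨
      ((v : ℕ) < 2 * r ∧ τ (2 * n + i) + D ≤ t ∧ ∃ U ⊆ (Finset.range r).erase i,
        height r v ≤ U.card ∧ ∀ j ∈ U, τ (2 * n + i) < τ (2 * n + j) ∧
          ∀ f ∈ tripTEdges (zigzag N r j (r - 2)) (τ (2 * n + j)), t ≤ f.time →
            height r f.head ≤ U.card) by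
    rcases H with H | H | H
    · exact H
    · rw [H, hNi] at hv
      omega
    · omega
  clear hv
  induction h with
  | start f hf hfs =>
    rcases inducedTG_hubTrips_cases hf with hc | ⟨w, hw, hc, hh, -⟩ | ⟨j, hj, hc⟩
    · rw [← hfs, hc, hhub] at hs
      omega
    · right; left
      have : (s : ℕ) = w := by rw [← hfs, hc, hN _ hw]
      rw [hh, hidef, this]
    · have := (zigzag_lt hN hn hj hk _ f hc).1
      rw [hfs] at this
      omega
  | @step u t _ f hf hfu ht ih =>
    rcases ih with ih | ih | ⟨hu, htD, U, hU, hcard, hUj⟩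
    · exact Or.inl ih
    · rw [ih] at hfu
      rcases inducedTG_hubTrips_cases hf with hc | ⟨w, hw, hc, hh, -⟩ | ⟨j, hj, hc⟩
      · have : (N (r - 1) : ℕ) = N (r + i) := by rw [← hc, hfu]
        omega
      · right; left
        have : w = r + i := by rw [← hNi, ← hfu, hc, hN _ hw]
        rw [hh, this, Nat.add_mod_left, Nat.mod_eq_of_lt hi]
      · right; right
        obtain ⟨h1, h2, h3⟩ := zigzag_lt hN hn hj hk _ f hc
        rw [hfu, hNi] at h3
        obtain ⟨hji, hf0, hft⟩ := h3 (by omega)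
        obtain rfl : j = i := by omega
        refine ⟨h2, hft.ge, ∅, by simp, ?_, by simp⟩
        rw [hf0, hN _ (by omega)]
        simp [height]
    · have hUr : U.card ≤ r - 1 := by
        simpa [Finset.card_erase_of_mem (Finset.mem_range.2 hi)] using Finset.card_le_card hU
      rcases inducedTG_hubTrips_cases hf with hc | ⟨w, hw, hc, hh, hf1⟩ | ⟨j, hj, hc⟩
      · left
        rw [← hfu, hc, hhub, height, if_pos (by omega)] at hcard
        have hUe : U = (Finset.range r).erase i := by
          apply Finset.eq_of_subset_of_card_le hU
          rw [Finset.card_erase_of_mem (Finset.mem_range.2 hi), Finset.card_range]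
          exact hcard
        intro j hj hji
        exact (hUj j (by rw [hUe]; simp [hj, hji])).1
      · right; right
        have hwr : w % r < r := Nat.mod_lt _ (by omega)
        have hh' : (f.head : ℕ) = r + w % r := by rw [hh, hN _ (by omega)]
        refine ⟨by omega, by linarith, U, hU, by rw [hh', height]; simp, ?_⟩
        intro j hj
        exact ⟨(hUj j hj).1, fun g hg hgt => (hUj j hj).2 g hg (by linarith)⟩
      · right; right
        obtain ⟨-, hlt, -⟩ := zigzag_lt hN hn hj hk _ f hc
        obtain ⟨-, hf1, hfe⟩ := zigzag_time N r j (r - 2) _ f hc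
        rw [← hD] at hfe
        by_cases hjU : j ∈ U
        · refine ⟨hlt, by linarith, U, hU, (hUj j hjU).2 f hc ht, ?_⟩
          intro j' hj'
          exact ⟨(hUj j' hj').1, fun g hg hgt => (hUj j' hj').2 g hg (by linarith)⟩
        · have hlate : τ (2 * n + i) < τ (2 * n + j) := by linarith
          have hji : j ≠ i := by
            rintro rfl
            exact lt_irrefl _ hlate
          have hbound := zigzag_height_le hN hn hj hk _ f hc
          rw [hfu] at hbound
          refine ⟨hlt, by linarith, insert j U, ?_, ?_, ?_⟩
          · exact Finset.insert_subset (by simp [hj, hji]) hU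
          · rw [Finset.card_insert_of_notMem hjU]
            exact (hbound f hc le_rfl).trans (by omega)
          · rw [Finset.card_insert_of_notMem hjU]
            intro j' hj'
            rcases Finset.mem_insert.1 hj' with rfl | hj'
            · refine ⟨hlate, fun g hg hgt => ?_⟩
              exact (hbound g hg (by linarith)).trans (by omega)
            · refine ⟨(hUj j' hj').1, fun g hg hgt => ?_⟩
              exact ((hUj j' hj').2 g hg (by linarith)).trans (by omega)

theorem isTripNetwork_hubTrips {n : ℕ} {N : ℕ → Fin n} (hN : ∀ k < n, (N k : ℕ) = k) (r : ℕ) :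
    IsTripNetwork (hubTrips N r n) := by
  constructor
  · intro T hT
    obtain ⟨m, -, rfl⟩ := List.mem_map.1 hT
    unfold hubTrip
    split_ifs
    · exact ⟨⟨by simp, List.isChain_singleton _⟩, by simp⟩
    · exact ⟨⟨by simp, List.isChain_singleton _⟩, by simp⟩
    · refine ⟨⟨zigzag_ne_nil _ _ _ _, (isChain_zigzag _ _ _ _).1⟩, fun e he => ?_⟩
      rw [weight_of_mem_zigzag _ _ _ _ e he]
      exact one_pos
  · intro v
    have hv := v.2
    refine ⟨hubTrip N r n v, List.mem_map.2 ⟨v, List.mem_range.2 (by omega), rfl⟩, ?_⟩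
    rw [hubTrip, if_pos hv]
    exact ⟨_, List.mem_singleton_self _, Or.inr (Fin.ext (hN _ hv))⟩

theorem stronglyTemporalisable_hubTrips {n r : ℕ} {N : ℕ → Fin n}
    (hN : ∀ k < n, (N k : ℕ) = k) (hr : 2 ≤ r) :
    StronglyTemporalisable (hubTrips N r n) := by
  intro s t
  have hi : (s : ℕ) % r < r := Nat.mod_lt _ (by omega)
  set i := (s : ℕ) % r with hidef
  set D : ℝ := 2 * ((r - 2 : ℕ) : ℝ) + 3 with hD
  have hDpos : 0 ≤ D := by positivity
  let τ : ℕ → ℝ := fun m =>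
    if m < n then r * D else if m < 2 * n then -1 else (Equiv.swap 0 i (m - 2 * n) : ℕ) * D
  refine ⟨τ, ?_⟩
  have hs := s.2
  have ht := t.2
  set G := inducedTG (hubTrips N r n) τ with hG
  have hzig : ∀ j < r, ∀ f ∈ tripTEdges (zigzag N r j (r - 2)) ((Equiv.swap 0 i j : ℕ) * D),
      f ∈ G := by
    intro j hj f hf
    refine mem_inducedTG_hubTrips.2 ⟨2 * n + j, by omega, ?_⟩
    have h1 : hubTrip N r n (2 * n + j) = zigzag N r j (r - 2) := by
      rw [hubTrip, if_neg (by omega), if_neg (by omega), Nat.add_sub_cancel_left]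
    have h2 : τ (2 * n + j) = (Equiv.swap 0 i j : ℕ) * D := by
      simp only [τ]
      rw [if_neg (by omega), if_neg (by omega), Nat.add_sub_cancel_left]
    rwa [h1, h2]
  have hclimb : ∀ k < r, ∃ a ≤ ((k : ℝ) + 1) * D, ArrivesAt G s (N k) a := by
    intro k
    induction k with
    | zero =>
      intro _
      have hQ : (⟨s, N (r + i), -1, 1⟩ : TEdge (Fin n)) ∈ G := by
        refine mem_inducedTG_hubTrips.2 ⟨n + s, by omega, ?_⟩
        have h2 : τ (n + s) = -1 := by
          simp only [τ]
          rw [if_neg (by omega), if_pos (by omega)]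
        have h3 : N s = s := Fin.ext (hN _ hs)
        rw [hubTrip, if_neg (by omega), if_pos (by omega), Nat.add_sub_cancel_left, h2, h3]
        exact List.mem_singleton_self _
      obtain ⟨f, hf, hf1, hf2⟩ :=
        exists_entry_mem_zigzag N r i (r - 2) ((Equiv.swap 0 i i : ℕ) * D)
      obtain ⟨ha, hb, hc⟩ := zigzag_time N r i (r - 2) _ f hf
      rw [← hD] at hc
      have hsw : Equiv.swap 0 i i = 0 := Equiv.swap_apply_right 0 i
      rw [hsw] at ha hc
      have := (ArrivesAt.start (s := s) _ hQ rfl).step f (hzig i hi f hf) hf1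
        (by simp at ha ⊢; exact ha)
      rw [hf2] at this
      exact ⟨_, by push_cast at *; linarith, this⟩
    | succ k ih =>
      intro hk
      obtain ⟨a, hak, harr⟩ := ih (by omega)
      have hj : Equiv.swap 0 i (k + 1) < r := by
        rw [Equiv.swap_apply_def]
        split_ifs <;> omega
      obtain ⟨f, hf, hf1, hf2⟩ := exists_climb_mem_zigzag N r (Equiv.swap 0 i (k + 1))
        (show k ≤ r - 2 by omega) ((Equiv.swap 0 i (Equiv.swap 0 i (k + 1)) : ℕ) * D)
      obtain ⟨ha, hb, hc⟩ := zigzag_time N r _ (r - 2) _ f hf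
      rw [← hD] at hc
      rw [Equiv.swap_apply_self] at ha hc
      push_cast at ha hc ⊢
      have := harr.step f (hzig _ hj f hf) hf1 (hak.trans ha)
      rw [hf2] at this
      exact ⟨_, by linarith, this⟩
  obtain ⟨a, ha, harr⟩ := hclimb (r - 1) (by omega)
  have hR : (⟨N (r - 1), t, r * D, 1⟩ : TEdge (Fin n)) ∈ G := by
    refine mem_inducedTG_hubTrips.2 ⟨t, by omega, ?_⟩
    have h2 : τ t = r * D := by
      simp only [τ]
      rw [if_pos ht]
    have h3 : N t = t := Fin.ext (hN _ ht)
    rw [hubTrip, if_pos ht, h2, h3]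
    exact List.mem_singleton_self _
  have hr1 : (((r - 1 : ℕ) : ℝ) + 1) = r := by
    rw [Nat.cast_sub (by omega)]
    push_cast
    ring
  rw [hr1] at ha
  exact (harr.step _ hR rfl ha).tReachable

theorem reachCount_hubTrips_le {n r : ℕ} {N : ℕ → Fin n} (hN : ∀ k < n, (N k : ℕ) = k)
    (hr : 2 ≤ r) (hn : n = r ^ 2 + 2 * r) (τ : ℕ → ℝ) :
    reachCount (inducedTG (hubTrips N r n) τ) ≤ n * (5 * r + 3) := by
  classical
  have hn2 : 2 * r ≤ n := by omega
  set G := inducedTG (hubTrips N r n) τ with hG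
  obtain ⟨i, hi⟩ : ∃ i, ∀ s t : Fin n, 2 * r ≤ (s : ℕ) → 2 * r ≤ (t : ℕ) → s ≠ t →
      TReachable G s t → (s : ℕ) % r = i := by
    by_cases hex : ∃ s t : Fin n, 2 * r ≤ (s : ℕ) ∧ 2 * r ≤ (t : ℕ) ∧ s ≠ t ∧ TReachable G s t
    · obtain ⟨s, t, hs, ht, hst, hreach⟩ := hex
      refine ⟨(s : ℕ) % r, fun s' t' hs' ht' hst' hreach' => ?_⟩
      obtain ⟨_, ha⟩ := hreach.exists_arrivesAt hst
      obtain ⟨_, ha'⟩ := hreach'.exists_arrivesAt hst'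
      by_contra hne
      have h1 := zigzag_first_of_arrivesAt hN hr hn2 hs ht ha _ (Nat.mod_lt s' (by omega)) hne
      have h2 := zigzag_first_of_arrivesAt hN hr hn2 hs' ht' ha' _ (Nat.mod_lt s (by omega))
        (Ne.symm hne)
      exact lt_asymm h1 h2
    · exact ⟨0, fun s t hs ht hst h => absurd ⟨s, t, hs, ht, hst, h⟩ hex⟩
  let A : Finset (Fin n) := Finset.univ.filter fun v => (v : ℕ) < 2 * r
  let B : Finset (Fin n) := Finset.univ.filter fun v => (v : ℕ) % r = i
  have hA : A.card ≤ 2 * r := by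
    rw [← Finset.card_range (2 * r)]
    refine Finset.card_le_card_of_injOn (fun v => (v : ℕ)) ?_ Fin.val_injective.injOn
    intro v hv
    simpa [A] using hv
  have hB : B.card ≤ r + 2 := by
    rw [← Finset.card_range (r + 2)]
    refine Finset.card_le_card_of_injOn (fun v => (v : ℕ) / r) ?_ ?_
    · intro v _
      have h : (v : ℕ) < (r + 2) * r := by
        calc (v : ℕ) < r ^ 2 + 2 * r := hn ▸ v.2
          _ = (r + 2) * r := by ring
      simpa using Nat.div_lt_of_lt_mul (by linarith)
    · intro v hv w hw hvw
      have hv' : (v : ℕ) % r = i := by simpa [B] using hv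
      have hw' : (w : ℕ) % r = i := by simpa [B] using hw
      have hvw' : (v : ℕ) / r = (w : ℕ) / r := hvw
      apply Fin.ext
      rw [← Nat.div_add_mod (v : ℕ) r, ← Nat.div_add_mod (w : ℕ) r, hv', hw', hvw']
  have hsub : (Finset.univ.filter fun p : Fin n × Fin n => TReachable G p.1 p.2) ⊆
      (A ×ˢ Finset.univ ∪ Finset.univ ×ˢ A) ∪ (B ×ˢ Finset.univ ∪ Finset.univ.diag) := by
    rintro ⟨s, t⟩ hst
    have hreach : TReachable G s t := by simpa using hst
    simp only [Finset.mem_union, Finset.mem_product, Finset.mem_univ, and_true, true_and,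
      Finset.mem_diag, A, B, Finset.mem_filter]
    by_contra! hcon
    obtain ⟨⟨h1, h2⟩, h3, h4⟩ := hcon
    exact h3 (hi s t h1 h2 h4 hreach)
  have hcount : reachCount G =
      (Finset.univ.filter fun p : Fin n × Fin n => TReachable G p.1 p.2).card := by
    rw [reachCount, Nat.card_eq_fintype_card, Fintype.card_subtype]
  rw [hcount]
  refine (Finset.card_le_card hsub).trans ?_
  refine (Finset.card_union_le _ _).trans ?_
  refine (add_le_add (Finset.card_union_le _ _) (Finset.card_union_le _ _)).trans ?_
  simp only [Finset.card_product, Finset.card_univ, Fintype.card_fin, Finset.diag_card]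
  have h1 := Nat.mul_le_mul_right n hA
  have h2 := Nat.mul_le_mul_left n hA
  have h3 := Nat.mul_le_mul_right n hB
  linarith


/-- Theorem: strong temporalisability does not give high
reachability. For every `r > 3` there is a strongly temporalisable trip network
on exactly `n = r² + 2r` nodes such that every temporalisation has
`τ`-reachability at most `15·n·√n`. -/
theorem exists_stronglyTemporalisable_low_reachability
    (r : ℕ) (hr : 3 < r) :
    ∃ trips : List (List (DEdge (Fin (r ^ 2 + 2 * r)))),
      IsTripNetwork trips ∧ StronglyTemporalisable trips ∧
      ∀ τ : ℕ → ℝ,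
        (reachCount (inducedTG trips τ) : ℝ) ≤
          15 * ((r : ℝ) ^ 2 + 2 * r) * Real.sqrt ((r : ℝ) ^ 2 + 2 * r) := by
  have hpos : 0 < r ^ 2 + 2 * r := by positivity
  let N : ℕ → Fin (r ^ 2 + 2 * r) := fun k => ⟨k % (r ^ 2 + 2 * r), Nat.mod_lt _ hpos⟩
  have hN : ∀ k < r ^ 2 + 2 * r, (N k : ℕ) = k := fun k hk => Nat.mod_eq_of_lt hk
  refine ⟨hubTrips N r (r ^ 2 + 2 * r), isTripNetwork_hubTrips hN r,
    stronglyTemporalisable_hubTrips hN (by omega), fun τ => ?_⟩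
  have hcount : (reachCount (inducedTG (hubTrips N r (r ^ 2 + 2 * r)) τ) : ℝ) ≤
      ((r : ℝ) ^ 2 + 2 * r) * (5 * r + 3) := by
    exact_mod_cast reachCount_hubTrips_le hN (by omega) rfl τ
  have hr3 : (3 : ℝ) < r := by exact_mod_cast hr
  have hsqrt : (r : ℝ) ≤ Real.sqrt ((r : ℝ) ^ 2 + 2 * r) := Real.le_sqrt_of_sq_le (by linarith)
  calc _ ≤ ((r : ℝ) ^ 2 + 2 * r) * (5 * r + 3) := hcount
    _ ≤ ((r : ℝ) ^ 2 + 2 * r) * (15 * Real.sqrt ((r : ℝ) ^ 2 + 2 * r)) := by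
      gcongr
      linarith
    _ = _ := by ring
end

section
/- Let (D,𝕋) be a trip network with n nodes containing nodes s and t, and let K∈ℕ. Construct (D',𝕋') by adding K new nodes z_1,…,z_K, adding the weight-1 edges (t,z_i) for i∈[K], and letting 𝕋' be 𝕋 together with one one-edge trip for each new edge. If (D,𝕋) is not (s,t)-temporalisable, then for every temporalisation τ' of (D',𝕋') the number of nodes τ'-reachable from s in (D',𝕋') is strictly less than n. -/
/-- Relabel the endpoints of an edge. -/
def liftEdge {V W : Type} (φ : V → W) (e : DEdge V) : DEdge W :=
  ⟨φ e.tail, φ e.head, e.weight⟩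

/-- The extended trip network of the gap reduction for `SS-MRTT`: `K` new nodes
`z_1, …, z_K` are added, together with the weight-1 edges `(t, z_i)` and the
corresponding one-edge trips. -/
def extTripsSS {V : Type} (trips : List (List (DEdge V))) (K : ℕ) (t : V) :
    List (List (DEdge (V ⊕ Fin K))) :=
  trips.map (List.map (liftEdge Sum.inl))
    ++ ((List.finRange K).map fun i =>
        [(⟨Sum.inl t, Sum.inr i, 1⟩ : DEdge (V ⊕ Fin K))])

/-- Relabel the endpoints of a temporal edge. -/
def liftTEdge {V W : Type} (φ : V → W) (f : TEdge V) : TEdge W :=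
  ⟨φ f.tail, φ f.head, f.time, f.travel⟩

theorem tripTEdges_map_liftEdge {V W : Type} (φ : V → W) (T : List (DEdge V)) (x : ℝ) :
    tripTEdges (T.map (liftEdge φ)) x = (tripTEdges T x).map (liftTEdge φ) := by
  induction T generalizing x with
  | nil => rfl
  | cons e T ih => simp [tripTEdges, ih, liftEdge, liftTEdge]

theorem mem_inducedTG_extTripsSS {V : Type} {trips : List (List (DEdge V))} {K : ℕ} {t : V}
    {τ : ℕ → ℝ} {f : TEdge (V ⊕ Fin K)} (hf : f ∈ inducedTG (extTripsSS trips K t) τ) :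
    (∃ g ∈ inducedTG trips τ, liftTEdge Sum.inl g = f) ∨ f.tail = Sum.inl t := by
  obtain ⟨⟨i, hi⟩, hf⟩ := hf
  by_cases h : i < trips.length
  · left
    have hget : (extTripsSS trips K t)[i] = (trips[i]).map (liftEdge Sum.inl) := by
      simp [extTripsSS, List.getElem_append_left, h]
    simp only [List.get_eq_getElem, hget, tripTEdges_map_liftEdge, List.mem_map] at hf
    obtain ⟨g, hg, rfl⟩ := hf
    exact ⟨g, ⟨⟨i, h⟩, hg⟩, rfl⟩
  · right
    simp only [List.get_eq_getElem, extTripsSS] at hf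
    rw [List.getElem_append_right (by simpa using h)] at hf
    simp only [List.getElem_map, tripTEdges, List.mem_singleton] at hf
    rw [hf]

/-- A list whose entries lie in the image of `S` under `φ` or satisfy `P` either lifts to a list
in `S`, or starts with a liftable prefix followed by an entry satisfying `P`. -/
theorem exists_map_prefix_of_forall_or {α β : Type} {S : Set α} {φ : α → β} {P : β → Prop}
    (p : List β) (hp : ∀ f ∈ p, (∃ g ∈ S, φ g = f) ∨ P f) :
    ∃ q : List α, (∀ g ∈ q, g ∈ S) ∧
      (p = q.map φ ∨ ∃ b r, P b ∧ p = q.map φ ++ b :: r) := by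
  induction p with
  | nil => exact ⟨[], by simp⟩
  | cons f p ih =>
    rcases hp f (by simp) with ⟨g, hg, rfl⟩ | hf
    · obtain ⟨q, hq, h⟩ := ih fun x hx => hp x (by simp [hx])
      refine ⟨g :: q, by simpa using ⟨hg, hq⟩, ?_⟩
      rcases h with rfl | ⟨b, r, hb, rfl⟩
      · exact Or.inl rfl
      · exact Or.inr ⟨b, r, hb, rfl⟩
    · exact ⟨[], by simp, Or.inr ⟨f, p, hf, rfl⟩⟩

theorem isTemporalPath_of_map_liftTEdge {V W : Type} {φ : V → W} (hφ : Function.Injective φ)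
    {G : Set (TEdge V)} {G' : Set (TEdge W)} {q : List (TEdge V)} (hq : ∀ g ∈ q, g ∈ G)
    {u : V} {w : W} (hp : IsTemporalPath G' (q.map (liftTEdge φ)) (φ u) w) :
    ∃ v, φ v = w ∧ IsTemporalPath G q u v := by
  obtain ⟨hne, -, hc, hh, hl⟩ := hp
  have hne' : q ≠ [] := by simpa using hne
  refine ⟨(q.getLast hne').head, ?_, hne', hq, ?_, ?_, ?_⟩
  · rw [List.getLast?_map, List.getLast?_eq_some_getLast hne'] at hl
    simpa [liftTEdge] using hl
  · refine ((List.isChain_map _).1 hc).imp ?_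
    exact fun a b hab => ⟨hφ hab.1, hab.2⟩
  · obtain ⟨a, l, rfl⟩ := List.exists_cons_of_ne_nil hne'
    simpa [liftTEdge, hφ.eq_iff] using hh
  · simp [List.getLast?_eq_some_getLast hne']

/-- If `t` is not reachable from `s` in the original network, then no new node is reachable
from `s` in the extended network, and reachability of the original nodes is unchanged. -/
theorem exists_tReachable_of_tReachable_extTripsSS {V : Type} {trips : List (List (DEdge V))}
    {K : ℕ} {s t : V} {τ : ℕ → ℝ} (hst : ¬ TReachable (inducedTG trips τ) s t)
    {w : V ⊕ Fin K} (hw : TReachable (inducedTG (extTripsSS trips K t) τ) (Sum.inl s) w) :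
    ∃ v, Sum.inl v = w ∧ TReachable (inducedTG trips τ) s v := by
  rcases hw with rfl | ⟨p, hp⟩
  · exact ⟨s, rfl, Or.inl rfl⟩
  obtain ⟨q, hq, rfl | ⟨b, r, hb, rfl⟩⟩ :=
    exists_map_prefix_of_forall_or p fun f hf => mem_inducedTG_extTripsSS (hp.2.1 f hf)
  · obtain ⟨v, hv, hpath⟩ := isTemporalPath_of_map_liftTEdge Sum.inl_injective hq hp
    exact ⟨v, hv, Or.inr ⟨q, hpath⟩⟩
  refine absurd ?_ hst
  obtain ⟨-, hmem, hc, hh, -⟩ := hp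
  rcases eq_or_ne q [] with rfl | hne
  · left
    simp only [List.map_nil, List.nil_append, List.head?_cons, Option.map_some, hb,
      Option.some.injEq, Sum.inl.injEq] at hh
    exact hh.symm
  · right
    obtain ⟨hc₁, -, hc₂⟩ := List.isChain_append.1 hc
    have hlast : (q.map (liftTEdge Sum.inl)).getLast?
        = some (liftTEdge Sum.inl (q.getLast hne) : TEdge (V ⊕ Fin K)) := by
      rw [List.getLast?_map, List.getLast?_eq_some_getLast hne, Option.map_some]
    have hlink := (hc₂ _ hlast b rfl).1
    have hpre : IsTemporalPath (inducedTG (extTripsSS trips K t) τ)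
        (q.map (liftTEdge Sum.inl)) (Sum.inl s) (Sum.inl t) := by
      refine ⟨by simpa using hne, fun f hf => hmem f (List.mem_append_left _ hf), hc₁, ?_, ?_⟩
      · obtain ⟨a, l, rfl⟩ := List.exists_cons_of_ne_nil hne
        simpa using hh
      · rw [hlast, Option.map_some, hlink, hb]
    obtain ⟨v, hv, hpath⟩ := isTemporalPath_of_map_liftTEdge Sum.inl_injective hq hpre
    exact ⟨q, Sum.inl_injective hv ▸ hpath⟩

/-- If `(D,𝕋)` is not `(s,t)`-temporalisable then in the
extended trip network every temporalisation makes strictly fewer than `n` nodes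
reachable from `s`. -/
theorem extended_single_source_of_not_temporalisable
    {V : Type} [Fintype V] (trips : List (List (DEdge V)))
    (hN : IsTripNetwork trips) (s t : V) (K : ℕ)
    (h : ¬ Temporalisable trips s t) :
    ∀ τ' : ℕ → ℝ,
      Nat.card {v : V ⊕ Fin K //
        TReachable (inducedTG (extTripsSS trips K t) τ') (Sum.inl s) v} <
        Fintype.card V := by
  intro τ'
  classical
  have hst : ¬ TReachable (inducedTG trips τ') s t := fun hr => h ⟨τ', hr⟩
  choose g hg hr using fun w : {v : V ⊕ Fin K //
      TReachable (inducedTG (extTripsSS trips K t) τ') (Sum.inl s) v} =>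
    exists_tReachable_of_tReachable_extTripsSS hst w.2
  have hinj : Function.Injective g := fun a b hab =>
    Subtype.ext (by rw [← hg a, ← hg b, hab])
  have hlt := Fintype.card_lt_of_injective_of_notMem g hinj (b := t) (by
    rintro ⟨w, hw⟩
    exact hst (hw ▸ hr w))
  rwa [Nat.card_eq_fintype_card]
end
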